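/- (Lemma 5) With G(v) = e^{v/2} α(e^v) β(e^{−v}) and Ĝ(t) = ∫_{−∞}^∞ e^{itv} G(v) dv, one has (1/2π) ∫_{−∞}^∞ Re(Γ'(1/4 + it/2)/Γ(1/4 + it/2)) Ĝ(t) dt = ∫_0^∞ [2 e^{−2v} α(1) β(1) − e^{−v} α(e^{−v}) β(e^{v}) − α(e^{v}) β(e^{−v})] / (1 − e^{−2v}) dv − γ α(1) β(1), where γ is Euler's constant and Γ'/Γ is the logarithmic derivative of the Gamma function. -/

import Mathlib

open scoped Real
open Real Complex MeasureTheory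

noncomputable section

/-- `a(2^l * m) = 2^l * σ₁(m)` for `m` odd; in particular `a(n) = σ₁(n)` for odd `n`. -/
def paperA (n : ℕ) : ℤ :=
  2 ^ (n.factorization 2) * (ArithmeticFunction.sigma 1 (ordCompl[2] n) : ℤ)

/-- `b(n) = σ₁(n)` for odd `n`, `b(n) = 0` for even `n`. -/
def paperB (n : ℕ) : ℤ :=
  if Odd n then (ArithmeticFunction.sigma 1 n : ℤ) else 0

/-- `α(u) = Σ_{k≥1} a(k) e^{−π k u}`. -/
def alphaFn (u : ℝ) : ℝ := ∑' k : ℕ, (paperA k : ℝ) * Real.exp (-(π * k * u))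

/-- `β(u) = Σ_{l≥1} b(l) e^{−π l u}`. -/
def betaFn (u : ℝ) : ℝ := ∑' l : ℕ, (paperB l : ℝ) * Real.exp (-(π * l * u))

/-- `G(v) = e^{v/2} α(e^v) β(e^{−v})`. -/
def paperG (v : ℝ) : ℝ := Real.exp (v / 2) * alphaFn (Real.exp v) * betaFn (Real.exp (-v))

/-- `Ĝ(t) = ∫_{−∞}^∞ e^{itv} G(v) dv`. -/
def paperGhat (t : ℝ) : ℂ := ∫ v : ℝ, Complex.exp (Complex.I * t * v) * (paperG v : ℂ)

section

open Filter Topology Set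

/-- The integrand of Gauss's integral for the digamma function. -/
def gaussKernel (s : ℂ) (x : ℝ) : ℂ :=
  (cexp (-x) - cexp (-(s * x))) / (1 - rexp (-x) : ℝ)

lemma one_sub_exp_neg_pos {x : ℝ} (hx : 0 < x) : 0 < 1 - rexp (-x) := by
  simpa using hx

lemma div_one_sub_exp_neg_le {x : ℝ} (hx : 0 < x) : x / (1 - rexp (-x)) ≤ 1 + x := by
  rw [div_le_iff₀ (one_sub_exp_neg_pos hx)]
  have h : rexp (-x) * (1 + x) ≤ 1 := by
    rw [Real.exp_neg, inv_mul_le_iff₀ (Real.exp_pos x)]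
    linarith [Real.add_one_le_exp x]
  linarith

lemma norm_gaussKernel_le {s : ℂ} {σ x : ℝ} (hσ : 0 < σ) (hσ1 : σ ≤ 1) (hs : σ ≤ s.re)
    (hx : 0 < x) :
    ‖gaussKernel s x‖ ≤ ‖s - 1‖ * (1 + 2 / σ) * rexp (-(σ / 2 * x)) := by
  have hpos := one_sub_exp_neg_pos hx
  have hnum : ‖cexp (-x) - cexp (-(s * x))‖ ≤ rexp (-(σ * x)) * (‖s - 1‖ * x) := by
    have h := (convex_halfSpace_re_le (-(σ * x))).norm_image_sub_le_of_norm_deriv_le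
      (𝕜 := ℂ) (f := cexp) (C := rexp (-(σ * x))) (x := -(s * x)) (y := -(x : ℂ))
      (fun z _ => Complex.differentiableAt_exp)
      (fun z hz => by simpa [Complex.norm_exp] using hz)
      (by simpa using mul_le_mul_of_nonneg_right hs hx.le)
      (by simpa using mul_le_mul_of_nonneg_right hσ1 hx.le)
    refine h.trans_eq ?_
    congr 1
    rw [show -(x : ℂ) - -(s * x) = (s - 1) * x by ring, norm_mul, Complex.norm_of_nonneg hx.le]
  have hexp : 1 + x ≤ (1 + 2 / σ) * rexp (σ / 2 * x) := by
    have h1 := Real.add_one_le_exp (σ / 2 * x)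
    have h2 : x = 2 / σ * (σ / 2 * x) := by field_simp
    have h3 : 1 ≤ rexp (σ / 2 * x) := Real.one_le_exp (by positivity)
    have h4 : 2 / σ * (σ / 2 * x) ≤ 2 / σ * rexp (σ / 2 * x) := by
      gcongr; linarith
    linarith
  rw [gaussKernel, norm_div, Complex.norm_of_nonneg hpos.le]
  calc _ ≤ rexp (-(σ * x)) * (‖s - 1‖ * x) / (1 - rexp (-x)) := by gcongr
    _ = ‖s - 1‖ * rexp (-(σ * x)) * (x / (1 - rexp (-x))) := by ring
    _ ≤ ‖s - 1‖ * rexp (-(σ * x)) * ((1 + 2 / σ) * rexp (σ / 2 * x)) := by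
      gcongr; exact (div_one_sub_exp_neg_le hx).trans hexp
    _ = ‖s - 1‖ * (1 + 2 / σ) * (rexp (-(σ * x)) * rexp (σ / 2 * x)) := by ring
    _ = _ := by rw [← Real.exp_add]; ring_nf

lemma measurable_gaussKernel (s : ℂ) : Measurable (gaussKernel s) := by
  unfold gaussKernel
  fun_prop

lemma integrableOn_gaussKernel {s : ℂ} (hs : 0 < s.re) : IntegrableOn (gaussKernel s) (Ioi 0) := by
  have hσ : 0 < min 1 s.re := lt_min one_pos hs
  refine Integrable.mono' (((integrableOn_exp_mul_Ioi (a := -(min 1 s.re / 2)) (by linarith)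
    0)).const_mul (‖s - 1‖ * (1 + 2 / min 1 s.re)))
    (measurable_gaussKernel s).aestronglyMeasurable ?_
  filter_upwards [ae_restrict_mem measurableSet_Ioi] with x hx
  simpa [neg_mul] using norm_gaussKernel_le hσ (min_le_left _ _) (min_le_right _ _) hx

lemma image_exp_neg_Ioi : (fun x : ℝ => rexp (-x)) '' Ioi 0 = Ioo 0 1 := by
  ext y
  simp only [mem_image, mem_Ioi, mem_Ioo]
  constructor
  · rintro ⟨x, hx, rfl⟩
    exact ⟨Real.exp_pos _, by simpa using hx⟩
  · rintro ⟨h0, h1⟩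
    exact ⟨-Real.log y, by simpa using Real.log_neg h0 h1, by simp [Real.exp_log h0]⟩

lemma betaIntegral_exp_substitution {s : ℂ} (hs : 0 < s.re) {ε : ℝ} (hε : 0 < ε) :
    IntegrableOn (fun x : ℝ => cexp (-(s * x)) * ((1 - rexp (-x)) ^ (ε - 1) : ℝ)) (Ioi 0) ∧
    ∫ x in Ioi (0 : ℝ), cexp (-(s * x)) * ((1 - rexp (-x)) ^ (ε - 1) : ℝ) =
      Complex.betaIntegral s ε := by
  set g : ℝ → ℂ := fun y => (y : ℂ) ^ (s - 1) * (1 - (y : ℂ)) ^ ((ε : ℂ) - 1) with hg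
  have hderiv : ∀ x ∈ Ioi (0 : ℝ),
      HasDerivWithinAt (fun x : ℝ => rexp (-x)) (-rexp (-x)) (Ioi 0) x := fun x _ => by
    simpa using (((hasDerivAt_id x).neg).exp).hasDerivWithinAt
  have hinj : InjOn (fun x : ℝ => rexp (-x)) (Ioi 0) := fun x _ y _ h => by simpa using h
  have heq : EqOn (fun x : ℝ => |-rexp (-x)| • g (rexp (-x)))
      (fun x : ℝ => cexp (-(s * x)) * ((1 - rexp (-x)) ^ (ε - 1) : ℝ)) (Ioi 0) := by
    intro x hx
    have hpos := one_sub_exp_neg_pos hx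
    simp only [hg]
    rw [abs_neg, abs_of_pos (Real.exp_pos _), Complex.real_smul, ← mul_assoc,
      Complex.ofReal_cpow hpos.le]
    congr 1
    · have hne : ((rexp (-x) : ℝ) : ℂ) ≠ 0 := by exact_mod_cast (Real.exp_pos _).ne'
      rw [Complex.cpow_sub _ _ hne, Complex.cpow_one, mul_div_cancel₀ _ hne,
        Complex.cpow_def_of_ne_zero hne, ← Complex.ofReal_log (Real.exp_pos _).le, Real.log_exp]
      congr 1
      push_cast; ring
    · push_cast; rfl
  have hint := Complex.betaIntegral_convergent hs (v := (ε : ℂ)) (by simpa using hε)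
  rw [intervalIntegrable_iff_integrableOn_Ioo_of_le zero_le_one, ← image_exp_neg_Ioi,
    integrableOn_image_iff_integrableOn_abs_deriv_smul measurableSet_Ioi hderiv hinj] at hint
  refine ⟨hint.congr_fun heq measurableSet_Ioi, ?_⟩
  rw [Complex.betaIntegral, intervalIntegral.integral_of_le zero_le_one,
    integral_Ioc_eq_integral_Ioo, ← image_exp_neg_Ioi,
    integral_image_eq_integral_abs_deriv_smul measurableSet_Ioi hderiv hinj]
  exact (setIntegral_congr_fun measurableSet_Ioi heq).symm

lemma integral_gaussKernel_mul_rpow {s : ℂ} (hs : 0 < s.re) {ε : ℝ} (hε : 0 < ε) :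
    ∫ x in Ioi (0 : ℝ), gaussKernel s x * ((1 - rexp (-x)) ^ ε : ℝ) =
      Complex.Gamma (ε + 1) *
        ((ε : ℂ)⁻¹ * (Complex.Gamma 1 / Complex.Gamma (1 + ε) -
          Complex.Gamma s / Complex.Gamma (s + ε))) := by
  obtain ⟨i1, e1⟩ := betaIntegral_exp_substitution (s := 1) (by simp) hε
  obtain ⟨i2, e2⟩ := betaIntegral_exp_substitution hs hε
  have hε0 : (ε : ℂ) ≠ 0 := by exact_mod_cast hε.ne'
  have key : ∀ z : ℂ, 0 < z.re → Complex.betaIntegral z ε =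
      Complex.Gamma (ε + 1) * ((ε : ℂ)⁻¹ * (Complex.Gamma z / Complex.Gamma (z + ε))) := by
    intro z hz
    have h := Complex.Gamma_mul_Gamma_eq_betaIntegral hz (t := (ε : ℂ)) (by simpa using hε)
    have h0 : Complex.Gamma (z + ε) ≠ 0 :=
      Complex.Gamma_ne_zero_of_re_pos (by simp; linarith)
    rw [Complex.Gamma_add_one _ hε0]
    field_simp
    linear_combination -h
  rw [mul_sub, mul_sub, ← key 1 (by simp), ← key s hs, ← e1, ← e2, ← integral_sub i1 i2]
  refine setIntegral_congr_fun measurableSet_Ioi fun x hx => ?_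
  have hpos := one_sub_exp_neg_pos hx
  have hne : ((1 - rexp (-x) : ℝ) : ℂ) ≠ 0 := by exact_mod_cast hpos.ne'
  simp only [gaussKernel]
  rw [Real.rpow_sub_one hpos.ne', Complex.ofReal_div, one_mul]
  field_simp

/-- **Gauss's integral** for the digamma function. -/
theorem digamma_eq_integral_gaussKernel {s : ℂ} (hs : 0 < s.re) :
    Complex.digamma s =
      -Real.eulerMascheroniConstant + ∫ x in Ioi (0 : ℝ), gaussKernel s x := by
  have hΓ : ∀ z : ℂ, 0 < z.re → HasDerivAt Complex.Gamma (deriv Complex.Gamma z) z := fun z hz =>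
    (Complex.differentiableAt_Gamma z fun m h => by
      rw [h] at hz; simp at hz; linarith [(Nat.cast_nonneg m : (0 : ℝ) ≤ m)]).hasDerivAt
  have hL : Tendsto (fun ε : ℝ => ∫ x in Ioi (0 : ℝ), gaussKernel s x * ((1 - rexp (-x)) ^ ε : ℝ))
      (𝓝[>] 0) (𝓝 (∫ x in Ioi (0 : ℝ), gaussKernel s x)) := by
    refine tendsto_integral_filter_of_dominated_convergence (fun x => ‖gaussKernel s x‖) ?_ ?_
      (integrableOn_gaussKernel hs).norm ?_
    · refine .of_forall fun ε => Measurable.aestronglyMeasurable ?_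
      exact (measurable_gaussKernel s).mul (by fun_prop)
    · filter_upwards [self_mem_nhdsWithin] with ε hε
      filter_upwards [ae_restrict_mem measurableSet_Ioi] with x hx
      have hpos := one_sub_exp_neg_pos hx
      rw [norm_mul, Complex.norm_of_nonneg (by positivity)]
      exact mul_le_of_le_one_right (norm_nonneg _)
        (Real.rpow_le_one hpos.le (by linarith [Real.exp_pos (-x)]) (le_of_lt hε))
    · filter_upwards [ae_restrict_mem measurableSet_Ioi] with x hx
      have hpos := one_sub_exp_neg_pos hx
      have h : Tendsto (fun ε : ℝ => (1 - rexp (-x)) ^ ε) (𝓝[>] 0) (𝓝 1) := by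
        simpa using ((Real.continuous_const_rpow hpos.ne').tendsto 0).mono_left nhdsWithin_le_nhds
      simpa using ((Complex.continuous_ofReal.tendsto 1).comp h).const_mul (gaussKernel s x)
  have hR : Tendsto (fun ε : ℝ => Complex.Gamma (ε + 1) *
        ((ε : ℂ)⁻¹ * (Complex.Gamma 1 / Complex.Gamma (1 + ε) -
          Complex.Gamma s / Complex.Gamma (s + ε)))) (𝓝[>] 0)
      (𝓝 (Complex.digamma s - Complex.digamma 1)) := by
    have hq : ∀ z : ℂ, 0 < z.re → HasDerivAt (fun ε : ℝ => Complex.Gamma z / Complex.Gamma (z + ε))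
        (-Complex.digamma z) 0 := by
      intro z hz
      have h0 := Complex.Gamma_ne_zero_of_re_pos hz
      have h1 : HasDerivAt (fun w : ℂ => Complex.Gamma (z + w)) (deriv Complex.Gamma z) 0 := by
        have := hΓ z hz
        rw [← add_zero z] at this
        simpa using this.comp_const_add z 0
      have h2 := ((hasDerivAt_const (0 : ℂ) (Complex.Gamma z)).div h1 (by simpa using h0))
      have h3 := HasDerivAt.comp_ofReal (z := 0) (by simpa using h2)
      convert! h3 using 1
      rw [Complex.digamma_def, logDeriv_apply]
      field_simp
    have hd := ((hq 1 (by simp)).sub (hq s hs)).tendsto_slope_zero_right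
    have hg : Tendsto (fun ε : ℝ => Complex.Gamma (ε + 1)) (𝓝[>] 0) (𝓝 1) := by
      have hc : ContinuousAt (fun ε : ℝ => Complex.Gamma (ε + 1)) 0 := by
        refine ContinuousAt.comp (g := Complex.Gamma) (f := fun ε : ℝ => (ε : ℂ) + 1) ?_ (by fun_prop)
        simpa using (hΓ 1 (by simp)).continuousAt
      simpa using hc.tendsto.mono_left nhdsWithin_le_nhds
    have h0 := Complex.Gamma_ne_zero_of_re_pos hs
    convert hg.mul hd using 2
    · simp [h0]
    · ring
  have hlim := tendsto_nhds_unique hL (hR.congr' (by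
    filter_upwards [self_mem_nhdsWithin] with ε hε
    exact (integral_gaussKernel_mul_rpow hs hε).symm))
  rw [hlim, Complex.digamma_one]
  ring

/-- The exponential series `∑ c(k) e^{-π k u}`. -/
def expSeries (c : ℕ → ℝ) (u : ℝ) : ℝ := ∑' k : ℕ, c k * rexp (-(π * k * u))

/-- Sequences of at most polynomial growth, vanishing at `0`. -/
def PolyGrowth (c : ℕ → ℝ) : Prop := ∃ (C : ℝ) (N : ℕ), ∀ k : ℕ, |c k| ≤ C * (k : ℝ) ^ (N + 1)

lemma PolyGrowth.natCast_mul {c : ℕ → ℝ} (hc : PolyGrowth c) : PolyGrowth fun k => k * c k := by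
  obtain ⟨C, N, h⟩ := hc
  refine ⟨C, N + 1, fun k => ?_⟩
  rw [abs_mul, Nat.abs_cast, pow_succ _ (N + 1)]
  calc (k : ℝ) * |c k| ≤ k * (C * (k : ℝ) ^ (N + 1)) := by gcongr; exact h k
    _ = _ := by ring

lemma PolyGrowth.exists_term_bound {c : ℕ → ℝ} (hc : PolyGrowth c) :
    ∃ P₀ : ℕ, ∀ P ≥ P₀, ∃ D : ℝ, 0 ≤ D ∧ ∀ u : ℝ, 0 < u → ∀ k : ℕ,
      ‖c k * rexp (-(π * k * u))‖ ≤ D / u ^ P * (1 / (k : ℝ) ^ 2) := by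
  obtain ⟨C, N, h⟩ := hc
  have hC : 0 ≤ C := by simpa using (abs_nonneg _).trans (h 1)
  refine ⟨N + 3, fun P hP => ⟨C * P.factorial, by positivity, fun u hu k => ?_⟩⟩
  rcases Nat.eq_zero_or_pos k with rfl | hk
  · have : c 0 = 0 := by simpa using h 0
    simp [this]
  have hk1 : (1 : ℝ) ≤ k := by exact_mod_cast hk
  have hx : 0 < (k : ℝ) * u := by positivity
  have hexp : rexp (-(π * k * u)) ≤ P.factorial / (k * u) ^ P := by
    calc rexp (-(π * k * u)) ≤ rexp (-(k * u)) := by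
          apply Real.exp_le_exp.2
          nlinarith [Real.pi_gt_three]
      _ ≤ P.factorial / (k * u) ^ P := by
          rw [Real.exp_neg, ← inv_div]
          exact inv_anti₀ (by positivity) (Real.pow_div_factorial_le_exp _ hx.le P)
  rw [norm_mul, Real.norm_eq_abs, Real.norm_of_nonneg (Real.exp_pos _).le]
  calc |c k| * rexp (-(π * k * u))
      ≤ C * (k : ℝ) ^ (N + 1) * (P.factorial / (k * u) ^ P) := by
        gcongr
        exact h k
    _ = C * P.factorial / u ^ P * ((k : ℝ) ^ (N + 1) / (k : ℝ) ^ P) := by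
        rw [mul_pow]; field_simp
    _ ≤ C * P.factorial / u ^ P * (1 / (k : ℝ) ^ 2) := by
        gcongr ?_ * ?_
        rw [div_le_div_iff₀ (by positivity) (by positivity), ← pow_add, one_mul]
        exact pow_le_pow_right₀ hk1 (by omega)

lemma summable_one_div_natCast_sq : Summable fun k : ℕ => 1 / (k : ℝ) ^ 2 :=
  Real.summable_one_div_nat_pow.2 one_lt_two

lemma PolyGrowth.summable {c : ℕ → ℝ} (hc : PolyGrowth c) {u : ℝ} (hu : 0 < u) :
    Summable fun k : ℕ => c k * rexp (-(π * k * u)) := by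
  obtain ⟨P, h⟩ := hc.exists_term_bound
  obtain ⟨D, -, hD⟩ := h P le_rfl
  exact .of_norm_bounded (summable_one_div_natCast_sq.mul_left _) (hD u hu)

lemma PolyGrowth.exists_bound {c : ℕ → ℝ} (hc : PolyGrowth c) :
    ∃ P₀ : ℕ, ∀ P ≥ P₀, ∃ D : ℝ, 0 ≤ D ∧ ∀ u : ℝ, 0 < u → |expSeries c u| ≤ D / u ^ P := by
  obtain ⟨P₀, h⟩ := hc.exists_term_bound
  refine ⟨P₀, fun P hP => ?_⟩
  obtain ⟨D, hD0, hD⟩ := h P hP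
  refine ⟨D * ∑' k : ℕ, 1 / (k : ℝ) ^ 2, by positivity, fun u hu => ?_⟩
  have := tsum_of_norm_bounded (summable_one_div_natCast_sq.mul_left (D / u ^ P)).hasSum (hD u hu)
  rw [tsum_mul_left] at this
  exact this.trans_eq (by ring)

lemma PolyGrowth.hasDerivAt_expSeries {c : ℕ → ℝ} (hc : PolyGrowth c) {u : ℝ} (hu : 0 < u) :
    HasDerivAt (expSeries c) (-π * expSeries (fun k => k * c k) u) u := by
  obtain ⟨P, h⟩ := hc.natCast_mul.exists_term_bound
  obtain ⟨D, hD0, hD⟩ := h P le_rfl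
  have key := hasDerivAt_tsum_of_isPreconnected (t := Ioi (u / 2)) (y₀ := u) (y := u)
    (g := fun (k : ℕ) y => c k * rexp (-(π * k * y)))
    (g' := fun (k : ℕ) y => -π * (k * c k * rexp (-(π * k * y))))
    ((summable_one_div_natCast_sq.mul_left (D / (u / 2) ^ P)).mul_left π) isOpen_Ioi
    isPreconnected_Ioi (fun k y _ => ?_) (fun k y hy => ?_) (by simpa using hu) (hc.summable hu)
    (by simpa using hu)
  · rw [tsum_mul_left] at key
    exact key
  · have := ((((hasDerivAt_id y).const_mul (π * k)).neg).exp).const_mul (c k)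
    convert! this using 1
    simp; ring
  · have hy' : 0 < y := (half_pos hu).trans hy
    rw [norm_mul, norm_neg, Real.norm_of_nonneg Real.pi_pos.le]
    refine mul_le_mul_of_nonneg_left ((hD y hy' k).trans ?_) Real.pi_pos.le
    gcongr
    exact le_of_lt hy

/-- `e^{r v} S_c(e^v) S_d(e^{-v})`, where `S_c`, `S_d` are the exponential series of `c`, `d`. -/
def expProduct (r : ℝ) (c d : ℕ → ℝ) (v : ℝ) : ℝ :=
  rexp (r * v) * expSeries c (rexp v) * expSeries d (rexp (-v))

section expProduct

variable {c d : ℕ → ℝ}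

lemma hasDerivAt_expProduct (hc : PolyGrowth c) (hd : PolyGrowth d) (r v : ℝ) :
    HasDerivAt (expProduct r c d)
      (r * expProduct r c d v - π * expProduct (r + 1) (fun k => k * c k) d v +
        π * expProduct (r - 1) c (fun k => k * d k) v) v := by
  have h1 : HasDerivAt (fun v => rexp (r * v)) (rexp (r * v) * r) v := by
    simpa using ((hasDerivAt_id v).const_mul r).exp
  have h2 := (hc.hasDerivAt_expSeries (Real.exp_pos v)).comp v (Real.hasDerivAt_exp v)
  have h3 := (hd.hasDerivAt_expSeries (Real.exp_pos (-v))).comp v ((hasDerivAt_id v).neg.exp)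
  convert! (h1.mul h2).mul h3 using 1
  have e1 : rexp ((r + 1) * v) = rexp (r * v) * rexp v := by rw [← Real.exp_add]; ring_nf
  have e2 : rexp ((r - 1) * v) = rexp (r * v) * rexp (-v) := by rw [← Real.exp_add]; ring_nf
  simp only [expProduct, Function.comp, Pi.mul_apply, Pi.neg_apply, id, e1, e2]
  ring

lemma continuous_expProduct (hc : PolyGrowth c) (hd : PolyGrowth d) (r : ℝ) :
    Continuous (expProduct r c d) :=
  continuous_iff_continuousAt.2 fun v => (hasDerivAt_expProduct hc hd r v).continuousAt

lemma exists_expProduct_bound (hc : PolyGrowth c) (hd : PolyGrowth d) (r : ℝ) :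
    ∃ D : ℝ, ∀ v, |expProduct r c d v| ≤ D * rexp (-|v|) := by
  obtain ⟨P₀, hP⟩ := hc.exists_bound
  obtain ⟨Q₀, hQ⟩ := hd.exists_bound
  have key : ∀ P ≥ P₀, ∀ Q ≥ Q₀, ∃ D : ℝ, 0 ≤ D ∧
      ∀ v, |expProduct r c d v| ≤ D * rexp ((r - P + Q) * v) := by
    intro P hP' Q hQ'
    obtain ⟨D₁, h₁, b₁⟩ := hP P hP'
    obtain ⟨D₂, h₂, b₂⟩ := hQ Q hQ'
    refine ⟨D₁ * D₂, by positivity, fun v => ?_⟩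
    rw [expProduct, abs_mul, abs_mul, abs_of_pos (Real.exp_pos _)]
    calc _ ≤ rexp (r * v) * (D₁ / rexp v ^ P) * (D₂ / rexp (-v) ^ Q) := by
          gcongr
          · exact b₁ _ (Real.exp_pos _)
          · exact b₂ _ (Real.exp_pos _)
      _ = D₁ * D₂ * (rexp (r * v) * (rexp v ^ P)⁻¹ * (rexp (-v) ^ Q)⁻¹) := by
          field_simp
      _ = _ := by
          rw [← Real.exp_nat_mul, ← Real.exp_nat_mul, ← Real.exp_neg, ← Real.exp_neg,
            ← Real.exp_add, ← Real.exp_add]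
          ring_nf
  obtain ⟨m, hm⟩ := exists_nat_ge (r + Q₀ + 1)
  obtain ⟨n, hn⟩ := exists_nat_ge (P₀ - r + 1)
  obtain ⟨D₁, h₁, b₁⟩ := key (P₀ + m) (by omega) Q₀ le_rfl
  obtain ⟨D₂, h₂, b₂⟩ := key P₀ le_rfl (Q₀ + n) (by omega)
  refine ⟨D₁ + D₂, fun v => ?_⟩
  rw [add_mul]
  rcases le_total 0 v with hv | hv
  · refine (b₁ v).trans (le_add_of_le_of_nonneg ?_ (by positivity))
    gcongr
    rw [abs_of_nonneg hv]
    push_cast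
    nlinarith [(Nat.cast_nonneg P₀ : (0 : ℝ) ≤ P₀)]
  · refine (b₂ v).trans (le_add_of_nonneg_of_le (by positivity) ?_)
    gcongr
    rw [abs_of_nonpos hv]
    push_cast
    nlinarith [(Nat.cast_nonneg Q₀ : (0 : ℝ) ≤ Q₀)]

lemma integrable_exp_neg_abs : Integrable fun v : ℝ => rexp (-|v|) := by
  rw [← integrableOn_univ, ← Iic_union_Ioi (a := (0 : ℝ))]
  refine ((integrableOn_exp_Iic 0).congr_fun (fun v hv => ?_) measurableSet_Iic).union
    ((integrableOn_exp_mul_Ioi neg_one_lt_zero 0).congr_fun (fun v hv => ?_) measurableSet_Ioi)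
  · simp [abs_of_nonpos (mem_Iic.1 hv)]
  · simp [abs_of_pos (mem_Ioi.1 hv)]

lemma integrable_expProduct (hc : PolyGrowth c) (hd : PolyGrowth d) (r : ℝ) :
    Integrable (expProduct r c d) := by
  obtain ⟨D, hD⟩ := exists_expProduct_bound hc hd r
  exact (integrable_exp_neg_abs.const_mul D).mono'
    (continuous_expProduct hc hd r).aestronglyMeasurable (.of_forall hD)

end expProduct

lemma polyGrowth_paperA : PolyGrowth fun k => (paperA k : ℝ) := by
  refine ⟨1, 1, fun k => ?_⟩
  have h : (2 ^ (k.factorization 2) * ArithmeticFunction.sigma 1 (ordCompl[2] k) : ℕ) ≤ k ^ 2 := by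
    calc _ ≤ (2 ^ (k.factorization 2)) ^ 2 * (ordCompl[2] k) ^ 2 := by
          exact Nat.mul_le_mul (Nat.le_self_pow two_ne_zero _)
            (ArithmeticFunction.sigma_le_pow_succ 1 _)
      _ = k ^ 2 := by rw [← mul_pow, Nat.ordProj_mul_ordCompl_eq_self]
  have e : (paperA k : ℝ) =
      ((2 ^ (k.factorization 2) * ArithmeticFunction.sigma 1 (ordCompl[2] k) : ℕ) : ℝ) := by
    simp [paperA]
  simp only [e, Nat.abs_cast, one_mul]
  exact_mod_cast h

lemma polyGrowth_paperB : PolyGrowth fun k => (paperB k : ℝ) := by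
  refine ⟨1, 1, fun k => ?_⟩
  rw [one_mul]
  by_cases hk : Odd k
  · simp only [paperB, hk, if_true, Int.cast_natCast, Nat.abs_cast]
    exact_mod_cast ArithmeticFunction.sigma_le_pow_succ 1 k
  · simp only [paperB, hk, if_false, Int.cast_zero, abs_zero]
    positivity

/-- The Fourier transform `t ↦ ∫ e^{i t v} f(v) dv`. -/
def expFourier (f : ℝ → ℂ) (t : ℝ) : ℂ := ∫ v : ℝ, cexp (I * t * v) * f v

lemma norm_cexp_I_mul_mul (t v : ℝ) : ‖cexp (I * t * v)‖ = 1 := by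
  rw [show I * t * v = ((t * v : ℝ) : ℂ) * I by push_cast; ring, Complex.norm_exp_ofReal_mul_I]

lemma integrable_cexp_mul {f : ℝ → ℂ} (hf : Integrable f) (t : ℝ) :
    Integrable fun v : ℝ => cexp (I * t * v) * f v :=
  hf.bdd_mul (c := 1) (by fun_prop) (.of_forall fun v => (norm_cexp_I_mul_mul t v).le)

lemma continuous_expFourier {f : ℝ → ℂ} (hf : Integrable f) : Continuous (expFourier f) := by
  refine continuous_of_dominated (bound := fun v => ‖f v‖)
    (fun t => (integrable_cexp_mul hf t).aestronglyMeasurable) (fun t => .of_forall fun v => ?_)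
    hf.norm (.of_forall fun v => by fun_prop)
  rw [norm_mul, norm_cexp_I_mul_mul, one_mul]

lemma norm_expFourier_le (f : ℝ → ℂ) (t : ℝ) : ‖expFourier f t‖ ≤ ∫ v, ‖f v‖ := by
  refine (norm_integral_le_integral_norm _).trans_eq ?_
  simp_rw [norm_mul, norm_cexp_I_mul_mul, one_mul]

lemma expFourier_deriv {f f' : ℝ → ℂ} (hf : Integrable f) (hf' : Integrable f')
    (h : ∀ v, HasDerivAt f (f' v) v) (t : ℝ) :
    expFourier f' t = -(I * t) * expFourier f t := by
  have hd : ∀ v : ℝ, HasDerivAt (fun v : ℝ => cexp (I * t * v)) (I * t * cexp (I * t * v)) v := by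
    intro v
    have := (((hasDerivAt_id (v : ℂ)).const_mul (I * t)).cexp).comp_ofReal
    simpa [mul_comm] using this
  have := integral_mul_deriv_eq_deriv_mul_of_integrable (fun v _ => hd v) (fun v _ => h v)
    (integrable_cexp_mul hf' t)
    (by simpa [mul_assoc, Pi.mul_def] using (integrable_cexp_mul hf t).const_mul (I * t))
    (integrable_cexp_mul hf t)
  rw [expFourier, this, expFourier, ← integral_const_mul, ← integral_neg]
  congr 1; ext v; ring

lemma expFourier_const_mul (a : ℂ) (f : ℝ → ℂ) (t : ℝ) :
    expFourier (fun v => a * f v) t = a * expFourier f t := by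
  simp only [expFourier, ← integral_const_mul, mul_left_comm]

lemma expFourier_add {f g : ℝ → ℂ} (hf : Integrable f) (hg : Integrable g) (t : ℝ) :
    expFourier (f + g) t = expFourier f t + expFourier g t := by
  simp only [expFourier, Pi.add_apply, mul_add]
  exact integral_add (integrable_cexp_mul hf t) (integrable_cexp_mul hg t)

lemma expFourier_sub {f g : ℝ → ℂ} (hf : Integrable f) (hg : Integrable g) (t : ℝ) :
    expFourier (f - g) t = expFourier f t - expFourier g t := by
  simp only [expFourier, Pi.sub_apply, mul_sub]
  exact integral_sub (integrable_cexp_mul hf t) (integrable_cexp_mul hg t)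

theorem integral_cexp_mul_expFourier {f : ℝ → ℂ} (hf : Integrable f) (hc : Continuous f)
    (hF : Integrable (expFourier f)) (v : ℝ) :
    ∫ t : ℝ, cexp (I * t * v) * expFourier f t = 2 * π * f (-v) := by
  have e : FourierTransform.fourier f = fun w : ℝ => expFourier f (-(2 * π) * w) := by
    ext w
    rw [Real.fourier_eq', expFourier]
    congr 1; ext x
    rw [smul_eq_mul]
    congr 2
    simp
    ring
  have hpi : -(2 * π) ≠ 0 := by simp [Real.pi_ne_zero]
  have h := hf.fourierInv_fourier_eq (v := -v) (by rw [e]; exact hF.comp_mul_left' hpi)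
    hc.continuousAt
  rw [← h, e, Real.fourierInv_eq']
  have h2 := Measure.integral_comp_mul_left
    (fun t : ℝ => cexp (I * t * v) * expFourier f t) (-(2 * π))
  have h3 : |(-(2 * π))⁻¹| = (2 * π)⁻¹ := by
    rw [abs_inv, abs_neg, abs_of_pos Real.two_pi_pos]
  rw [h3, Complex.real_smul] at h2
  have h4 : (2 * π : ℂ) ≠ 0 := by simp [Real.pi_ne_zero]
  have h5 : ∫ w : ℝ, cexp ((2 * π * inner ℝ w (-v) : ℝ) * I) • expFourier f (-(2 * π) * w) =
      ∫ w : ℝ, cexp (I * (-(2 * π) * w : ℝ) * v) * expFourier f (-(2 * π) * w) := by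
    congr 1; ext w
    rw [smul_eq_mul]
    congr 2
    simp
    ring
  rw [h5, h2]
  push_cast
  rw [mul_inv_cancel_left₀ h4]

section decay

variable {c d : ℕ → ℝ}

lemma integrable_ofReal_expProduct (hc : PolyGrowth c) (hd : PolyGrowth d) (r : ℝ) :
    Integrable fun v => (expProduct r c d v : ℂ) :=
  (integrable_expProduct hc hd r).ofReal

lemma exists_pow_mul_expFourier_expProduct_bound (n : ℕ) :
    ∀ {c d : ℕ → ℝ}, PolyGrowth c → PolyGrowth d → ∀ r : ℝ,
      ∃ D : ℝ, ∀ t : ℝ, |t| ^ n * ‖expFourier (fun v => (expProduct r c d v : ℂ)) t‖ ≤ D := by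
  induction n with
  | zero => exact fun _ _ r => ⟨_, fun t => by simpa using norm_expFourier_le _ t⟩
  | succ n ih =>
    intro c d hc hd r
    obtain ⟨D₁, h₁⟩ := ih hc hd r
    obtain ⟨D₂, h₂⟩ := ih hc.natCast_mul hd (r + 1)
    obtain ⟨D₃, h₃⟩ := ih hc hd.natCast_mul (r - 1)
    refine ⟨|r| * D₁ + π * D₂ + π * D₃, fun t => ?_⟩
    have i₁ := integrable_ofReal_expProduct hc hd r
    have i₂ := integrable_ofReal_expProduct hc.natCast_mul hd (r + 1)
    have i₃ := integrable_ofReal_expProduct hc hd.natCast_mul (r - 1)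
    have lin : -(I * t) * expFourier (fun v => (expProduct r c d v : ℂ)) t =
        r * expFourier (fun v => (expProduct r c d v : ℂ)) t -
        π * expFourier (fun v => (expProduct (r + 1) (fun k => k * c k) d v : ℂ)) t +
        π * expFourier (fun v => (expProduct (r - 1) c (fun k => k * d k) v : ℂ)) t := by
      rw [← expFourier_deriv i₁
        (((i₁.const_mul (r : ℂ)).sub (i₂.const_mul (π : ℂ))).add (i₃.const_mul (π : ℂ)))
        (fun v => by simpa using! (hasDerivAt_expProduct hc hd r v).ofReal_comp) t,
        expFourier_add ((i₁.const_mul _).sub (i₂.const_mul _)) (i₃.const_mul _),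
        expFourier_sub (i₁.const_mul _) (i₂.const_mul _),
        expFourier_const_mul, expFourier_const_mul, expFourier_const_mul]
    have hn : |t| * ‖expFourier (fun v => (expProduct r c d v : ℂ)) t‖ =
        ‖-(I * t) * expFourier (fun v => (expProduct r c d v : ℂ)) t‖ := by
      simp
    rw [pow_succ, mul_assoc, hn, lin]
    refine (mul_le_mul_of_nonneg_left ((norm_add_le _ _).trans
      (add_le_add_left (norm_sub_le _ _) _)) (by positivity)).trans ?_
    simp only [norm_mul, Complex.norm_real, Real.norm_eq_abs, abs_of_pos Real.pi_pos]
    calc _ = |r| * (|t| ^ n * ‖expFourier (fun v => (expProduct r c d v : ℂ)) t‖) +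
        π * (|t| ^ n * ‖expFourier (fun v =>
          (expProduct (r + 1) (fun k => k * c k) d v : ℂ)) t‖) +
        π * (|t| ^ n * ‖expFourier (fun v =>
          (expProduct (r - 1) c (fun k => k * d k) v : ℂ)) t‖) := by ring
      _ ≤ _ := by
        gcongr
        · exact h₁ t
        · exact h₂ t
        · exact h₃ t

lemma integrable_one_add_abs_mul_expFourier_expProduct (hc : PolyGrowth c) (hd : PolyGrowth d)
    (r : ℝ) :
    Integrable fun t : ℝ => (1 + |t|) * ‖expFourier (fun v => (expProduct r c d v : ℂ)) t‖ := by
  choose D hD using fun n => exists_pow_mul_expFourier_expProduct_bound n hc hd r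
  have hcont := continuous_expFourier (integrable_ofReal_expProduct hc hd r)
  refine (integrable_inv_one_add_sq.const_mul (D 0 + D 1 + D 2 + D 3)).mono'
    (by fun_prop) (.of_forall fun t => ?_)
  rw [Real.norm_of_nonneg (by positivity), ← div_eq_mul_inv, le_div_iff₀ (by positivity), ← sq_abs]
  linarith [hD 0 t, hD 1 t, hD 2 t, hD 3 t]

end decay

lemma ofReal_re_gaussKernel (t x : ℝ) :
    ((gaussKernel (1 / 4 + I * t / 2) x).re : ℂ) =
      (rexp (-x) - rexp (-(x / 4)) *
        ((cexp (I * t * (x / 2 : ℝ)) + cexp (I * t * (-(x / 2) : ℝ))) / 2)) /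
        (1 - rexp (-x) : ℝ) := by
  have h1 : cexp (-((1 / 4 + I * t / 2) * x)) = rexp (-(x / 4)) * cexp (-(t * x / 2) * I) := by
    push_cast
    rw [← Complex.exp_add]
    ring_nf
  have h2 : (cexp (I * t * (x / 2 : ℝ)) + cexp (I * t * (-(x / 2) : ℝ))) / 2 =
      (Real.cos (t * x / 2) : ℂ) := by
    push_cast
    rw [Complex.cos]
    ring_nf
  have h3 : cexp (-(t * x / 2) * I) = Real.cos (t * x / 2) - Real.sin (t * x / 2) * I := by
    rw [Complex.exp_mul_I, Complex.cos_neg, Complex.sin_neg]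
    push_cast
    ring
  have h4 : gaussKernel (1 / 4 + I * t / 2) x =
      ((rexp (-x) - rexp (-(x / 4)) * Real.cos (t * x / 2)) / (1 - rexp (-x)) : ℝ) +
        (rexp (-(x / 4)) * Real.sin (t * x / 2) / (1 - rexp (-x)) : ℝ) * I := by
    rw [gaussKernel, h1, h3]
    push_cast
    ring
  rw [h2, h4, Complex.add_re, Complex.ofReal_re, Complex.re_ofReal_mul, Complex.I_re, mul_zero,
    add_zero]
  push_cast
  rfl

lemma re_digamma_eq_integral {s : ℂ} (hs : 0 < s.re) :
    (Complex.digamma s).re =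
      -Real.eulerMascheroniConstant + ∫ x in Ioi (0 : ℝ), (gaussKernel s x).re := by
  have h : ∫ x in Ioi (0 : ℝ), (gaussKernel s x).re =
      (∫ x in Ioi (0 : ℝ), gaussKernel s x).re := integral_re (integrableOn_gaussKernel hs)
  rw [digamma_eq_integral_gaussKernel hs, h]
  simp

section pairing

variable {f : ℝ → ℂ}

lemma integrable_expFourier_of_weighted (hf : Integrable f)
    (hw : Integrable fun t : ℝ => (1 + |t|) * ‖expFourier f t‖) : Integrable (expFourier f) := by
  refine hw.mono' (continuous_expFourier hf).aestronglyMeasurable (.of_forall fun t => ?_)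
  exact le_mul_of_one_le_left (norm_nonneg _) (by simp)

lemma integrable_prod_gaussKernel_mul_expFourier (hf : Integrable f)
    (hw : Integrable fun t : ℝ => (1 + |t|) * ‖expFourier f t‖) :
    Integrable (fun p : ℝ × ℝ =>
      ((gaussKernel (1 / 4 + I * p.1 / 2) p.2).re : ℂ) * expFourier f p.1)
      (volume.prod (volume.restrict (Ioi 0))) := by
  have hcont := continuous_expFourier hf
  have he : Integrable (fun x : ℝ => 9 * rexp (-(1 / 8) * x)) (volume.restrict (Ioi 0)) :=
    (integrableOn_exp_mul_Ioi (by norm_num) 0).const_mul 9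
  refine (hw.mul_prod he).mono' ?_ ?_
  · simp only [gaussKernel]
    have := hcont.measurable
    exact Measurable.aestronglyMeasurable (by fun_prop)
  · have hx : ∀ᵐ p : ℝ × ℝ ∂(volume.prod (volume.restrict (Ioi 0))), p.2 ∈ Ioi (0 : ℝ) :=
      Measure.quasiMeasurePreserving_snd.ae (ae_restrict_mem measurableSet_Ioi)
    filter_upwards [hx] with p hp
    have hk := norm_gaussKernel_le (s := 1 / 4 + I * p.1 / 2) (σ := 1 / 4) (by norm_num)
      (by norm_num) (by simp) hp
    have hs : ‖(1 / 4 + I * p.1 / 2 : ℂ) - 1‖ ≤ 1 + |p.1| := by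
      rw [show (1 / 4 + I * p.1 / 2 : ℂ) - 1 = (-(3 / 4) : ℝ) + I * (p.1 / 2 : ℝ) by
        push_cast; ring]
      refine (norm_add_le _ _).trans ?_
      rw [norm_mul, Complex.norm_real, Complex.norm_real, norm_I, one_mul, Real.norm_eq_abs,
        Real.norm_eq_abs, abs_neg, abs_of_pos (by norm_num : (0 : ℝ) < 3 / 4), abs_div, abs_two]
      linarith [abs_nonneg p.1]
    rw [norm_mul, Complex.norm_real, Real.norm_eq_abs]
    calc _ ≤ (1 + |p.1|) * 9 * rexp (-(1 / 8) * p.2) * ‖expFourier f p.1‖ := by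
          refine mul_le_mul_of_nonneg_right ((abs_re_le_norm _).trans (hk.trans ?_)) (norm_nonneg _)
          norm_num at hs ⊢
          gcongr
      _ = _ := by ring

lemma integral_re_gaussKernel_mul_expFourier (hf : Integrable f) (hc : Continuous f)
    (hF : Integrable (expFourier f)) (x : ℝ) :
    ∫ t : ℝ, ((gaussKernel (1 / 4 + I * t / 2) x).re : ℂ) * expFourier f t =
      π * (2 * rexp (-x) * f 0 - rexp (-(x / 4)) * (f (x / 2) + f (-(x / 2)))) /
        (1 - rexp (-x) : ℝ) := by
  have h0 : ∫ t : ℝ, expFourier f t = 2 * π * f 0 := by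
    simpa using integral_cexp_mul_expFourier hf hc hF 0
  have hp := integral_cexp_mul_expFourier hf hc hF (x / 2)
  have hm := integral_cexp_mul_expFourier hf hc hF (-(x / 2))
  rw [neg_neg] at hm
  have ip : Integrable fun t : ℝ => cexp (I * t * (x / 2 : ℝ)) * expFourier f t :=
    hF.bdd_mul (c := 1) (by fun_prop) (.of_forall fun t => (norm_cexp_I_mul_mul t _).le)
  have im : Integrable fun t : ℝ => cexp (I * t * (-(x / 2) : ℝ)) * expFourier f t :=
    hF.bdd_mul (c := 1) (by fun_prop) (.of_forall fun t => (norm_cexp_I_mul_mul t _).le)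
  have e : ∀ t : ℝ, ((gaussKernel (1 / 4 + I * t / 2) x).re : ℂ) * expFourier f t =
      (rexp (-x) / (1 - rexp (-x) : ℝ)) * expFourier f t -
      (rexp (-(x / 4)) / (2 * (1 - rexp (-x) : ℝ))) *
        (cexp (I * t * (x / 2 : ℝ)) * expFourier f t +
          cexp (I * t * (-(x / 2) : ℝ)) * expFourier f t) := fun t => by
    rw [ofReal_re_gaussKernel]
    ring
  simp_rw [e]
  have isum := (integral_add ip im).trans (congrArg₂ _ hp hm)
  rw [integral_sub (hF.const_mul _) (Integrable.const_mul (by exact ip.add im) _),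
    integral_const_mul, integral_const_mul, isum, h0]
  ring

theorem integral_re_digamma_mul_expFourier (hf : Integrable f) (hc : Continuous f)
    (hw : Integrable fun t : ℝ => (1 + |t|) * ‖expFourier f t‖) :
    ∫ t : ℝ, ((Complex.digamma (1 / 4 + I * t / 2)).re : ℂ) * expFourier f t =
      2 * π * ((∫ v in Ioi (0 : ℝ),
        (2 * rexp (-2 * v) * f 0 - rexp (-(v / 2)) * (f v + f (-v))) / (1 - rexp (-2 * v) : ℝ)) -
        Real.eulerMascheroniConstant * f 0) := by
  have hF := integrable_expFourier_of_weighted hf hw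
  have hprod := integrable_prod_gaussKernel_mul_expFourier hf hw
  have e : ∀ t : ℝ, ((Complex.digamma (1 / 4 + I * t / 2)).re : ℂ) * expFourier f t =
      -Real.eulerMascheroniConstant * expFourier f t +
        ∫ x in Ioi (0 : ℝ), ((gaussKernel (1 / 4 + I * t / 2) x).re : ℂ) * expFourier f t := by
    intro t
    rw [re_digamma_eq_integral (by simp), integral_mul_const, integral_complex_ofReal]
    push_cast
    ring
  have h0 : ∫ t : ℝ, expFourier f t = 2 * π * f 0 := by
    simpa using integral_cexp_mul_expFourier hf hc hF 0
  have hsub := integral_comp_mul_left_Ioi (fun x : ℝ =>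
    π * (2 * rexp (-x) * f 0 - rexp (-(x / 4)) * (f (x / 2) + f (-(x / 2)))) /
        (1 - rexp (-x) : ℝ)) 0 (two_pos)
  rw [mul_zero, Complex.real_smul, eq_comm, Complex.ofReal_inv, Complex.ofReal_ofNat,
    inv_mul_eq_iff_eq_mul₀ two_ne_zero] at hsub
  simp_rw [e]
  rw [integral_add (hF.const_mul _) hprod.integral_prod_left, integral_const_mul, h0,
    integral_integral_swap hprod]
  simp_rw [integral_re_gaussKernel_mul_expFourier hf hc hF]
  rw [hsub, mul_sub, ← integral_const_mul, ← integral_const_mul, neg_mul, neg_add_eq_sub]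
  congr 1
  · congr 1; ext v
    rw [mul_div_cancel_left₀ v two_ne_zero, show 2 * v / 4 = v / 2 by ring, neg_mul]
    ring
  · ring

end pairing

lemma paperG_eq_expProduct :
    paperG = expProduct (1 / 2) (fun k => (paperA k : ℝ)) fun k => (paperB k : ℝ) := by
  ext v
  rw [paperG, expProduct, one_div_mul_eq_div]
  rfl

end

theorem lemma_five :
    (1 / (2 * π) : ℂ) *
        ∫ t : ℝ,
          ((deriv Complex.Gamma (1 / 4 + Complex.I * t / 2) /
              Complex.Gamma (1 / 4 + Complex.I * t / 2)).re : ℂ) * paperGhat t =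
      ((∫ v in Set.Ioi (0 : ℝ),
          (2 * Real.exp (-2 * v) * alphaFn 1 * betaFn 1 -
              Real.exp (-v) * alphaFn (Real.exp (-v)) * betaFn (Real.exp v) -
              alphaFn (Real.exp v) * betaFn (Real.exp (-v))) / (1 - Real.exp (-2 * v))) -
        Real.eulerMascheroniConstant * (alphaFn 1 * betaFn 1) : ℝ) := by
  have hA := polyGrowth_paperA
  have hB := polyGrowth_paperB
  have key := integral_re_digamma_mul_expFourier (integrable_ofReal_expProduct hA hB (1 / 2))
    (Complex.continuous_ofReal.comp (continuous_expProduct hA hB (1 / 2)))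
    (integrable_one_add_abs_mul_expFourier_expProduct hA hB (1 / 2))
  rw [← paperG_eq_expProduct] at key
  have hpi : (2 * π : ℂ) ≠ 0 := by simp [Real.pi_ne_zero]
  have hG0 : paperG 0 = alphaFn 1 * betaFn 1 := by simp [paperG]
  simp only [Complex.digamma_def, logDeriv_apply] at key
  change (1 / (2 * π) : ℂ) * ∫ t : ℝ, ((deriv Complex.Gamma (1 / 4 + Complex.I * t / 2) /
    Complex.Gamma (1 / 4 + Complex.I * t / 2)).re : ℂ) *
      expFourier (fun v => (paperG v : ℂ)) t = _
  rw [key, one_div, inv_mul_cancel_left₀ hpi, hG0]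
  rw [Complex.ofReal_sub, ← integral_complex_ofReal, Complex.ofReal_mul]
  congr 1
  swap
  · push_cast
    rfl
  congr 1
  ext v
  have h1 : rexp (-(v / 2)) * paperG v = alphaFn (rexp v) * betaFn (rexp (-v)) := by
    rw [paperG, mul_assoc, ← mul_assoc, ← Real.exp_add, neg_add_cancel, Real.exp_zero, one_mul]
  have h2 : rexp (-(v / 2)) * paperG (-v) = rexp (-v) * alphaFn (rexp (-v)) * betaFn (rexp v) := by
    rw [paperG, neg_neg, ← mul_assoc, ← mul_assoc, ← Real.exp_add]
    ring_nf
  rw [show 2 * rexp (-2 * v) * alphaFn 1 * betaFn 1 -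
      rexp (-v) * alphaFn (rexp (-v)) * betaFn (rexp v) - alphaFn (rexp v) * betaFn (rexp (-v)) =
      2 * rexp (-2 * v) * (alphaFn 1 * betaFn 1) -
        rexp (-(v / 2)) * (paperG v + paperG (-v)) by rw [mul_add, h1, h2]; ring]
  simp only [Complex.ofReal_div, Complex.ofReal_sub, Complex.ofReal_mul, Complex.ofReal_add,
    Complex.ofReal_ofNat]
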